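/- arXiv:2602.00358 — 2 statements merged into one kernel-verified Lean document; each statement's English description precedes it below -/
import Mathlib

section
/- Let 𝒜 be a unital C*-algebra, let a, b ∈ 𝒜 be positive elements, and let t ∈ [1/4, 3/4]. Then ‖a^t b^(1-t) + b^t a^(1-t)‖ ≤ ‖a + b‖. -/
section CrossedHeinz

variable {A : Type*} [CStarAlgebra A] [PartialOrder A] [StarOrderedRing A]

lemma CFC.rpow_mul_rpow_of_nonneg (a : A) {x y : ℝ} (hx : 0 ≤ x) (hy : 0 ≤ y) :
    a ^ x * a ^ y = a ^ (x + y) := by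
  simp only [CFC.rpow_def]
  rw [← cfc_mul _ _ a (NNReal.continuous_rpow_const hx).continuousOn
    (NNReal.continuous_rpow_const hy).continuousOn]
  exact cfc_congr fun z _ => (NNReal.rpow_add_of_nonneg z hx hy).symm

lemma CFC.star_rpow (a : A) (x : ℝ) : star (a ^ x) = a ^ x :=
  (IsSelfAdjoint.of_nonneg CFC.rpow_nonneg).star_eq

open scoped InnerProductSpace in
/-- The Cauchy–Schwarz inequality for a row times a column over a C⋆-algebra. -/
lemma CStarAlgebra.norm_mul_add_mul_sq_le (x y c d : A) :
    ‖x * c + y * d‖ ^ 2 ≤ ‖x * star x + y * star y‖ * ‖star c * c + star d * d‖ := by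
  let u : WithCStarModule A (A × A) := WithCStarModule.equiv A (A × A) |>.symm (star c, star d)
  let v : WithCStarModule A (A × A) := WithCStarModule.equiv A (A × A) |>.symm (x, y)
  have huv : ⟪u, v⟫_A = x * c + y * d := by
    simp [u, v, WithCStarModule.prod_inner, WithCStarModule.inner_def]
  have hu : ‖u‖ ^ 2 = ‖star c * c + star d * d‖ := by
    simp [u, WithCStarModule.prod_norm_sq, WithCStarModule.inner_def]
  have hv : ‖v‖ ^ 2 = ‖x * star x + y * star y‖ := by
    simp [v, WithCStarModule.prod_norm_sq, WithCStarModule.inner_def]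
  rw [← huv, ← hu, ← hv, ← mul_pow, mul_comm ‖v‖]
  gcongr
  exact CStarModule.norm_inner_le _

lemma CFC.rpow_conj_rpow_le {a b : A} (ha : 0 ≤ a) (hb : 0 ≤ b) {M r : ℝ}
    (hM : a + b ≤ algebraMap ℝ A M) (hr : r ∈ Set.Icc (0 : ℝ) 1) :
    a ^ ((1 - r) / 2) * b ^ r * a ^ ((1 - r) / 2) ≤
      (1 - r) • a + r • (algebraMap ℝ A M - a) := by
  obtain ⟨hr0, hr1⟩ := hr
  have haM : a ≤ algebraMap ℝ A M := le_trans (le_add_of_nonneg_right hb) hM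
  have hspec : ∀ s ∈ spectrum ℝ a, 0 ≤ s ∧ s ≤ M := fun s hs =>
    ⟨spectrum_nonneg_of_nonneg ha hs, (le_algebraMap_iff_spectrum_le (a := a)).mp haM s hs⟩
  have hq : ContinuousOn (fun s : ℝ => s ^ ((1 - r) / 2)) (spectrum ℝ a) :=
    (Real.continuous_rpow_const (by linarith)).continuousOn
  have hp : ContinuousOn (fun s : ℝ => (M - s) ^ r) (spectrum ℝ a) :=
    ((Real.continuous_rpow_const hr0).comp
      (by fun_prop : Continuous fun s : ℝ => M - s)).continuousOn
  have hsub : algebraMap ℝ A M - a = cfc (fun s : ℝ => M - s) a := by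
    rw [cfc_sub (fun _ : ℝ => M) (fun s : ℝ => s) a, cfc_const M a, cfc_id' ℝ a]
  have hpow : (algebraMap ℝ A M - a) ^ r = cfc (fun s : ℝ => (M - s) ^ r) a := by
    rw [CFC.rpow_eq_cfc_real (sub_nonneg.mpr haM), hsub]
    exact (cfc_comp' (fun s : ℝ => s ^ r) (fun s : ℝ => M - s) a
      (Real.continuous_rpow_const hr0).continuousOn).symm
  calc a ^ ((1 - r) / 2) * b ^ r * a ^ ((1 - r) / 2)
      ≤ a ^ ((1 - r) / 2) * (algebraMap ℝ A M - a) ^ r * a ^ ((1 - r) / 2) :=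
        (IsSelfAdjoint.of_nonneg CFC.rpow_nonneg).conjugate_le_conjugate
          (CFC.monotone_rpow ⟨hr0, hr1⟩ (le_sub_iff_add_le'.mpr hM))
    _ = cfc (fun s : ℝ => s ^ ((1 - r) / 2) * (M - s) ^ r * s ^ ((1 - r) / 2)) a := by
        rw [cfc_mul (fun s : ℝ => s ^ ((1 - r) / 2) * (M - s) ^ r) _ a (hq.mul hp) hq, cfc_mul _ _ a hq hp, hpow, CFC.rpow_eq_cfc_real ha]
    _ ≤ cfc (fun s : ℝ => (1 - r) * s + r * (M - s)) a := by
        refine cfc_mono (fun s hs => ?_) ((hq.mul hp).mul hq)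
        obtain ⟨hs0, hsM⟩ := hspec s hs
        have h := Real.geom_mean_le_arith_mean2_weighted (sub_nonneg.mpr hr1) hr0 hs0
          (sub_nonneg.mpr hsM) (by ring)
        have hs : s ^ (1 - r) = s ^ ((1 - r) / 2) * s ^ ((1 - r) / 2) := by
          rw [← Real.rpow_add_of_nonneg hs0 (by linarith) (by linarith), add_halves]
        rw [hs] at h
        linarith
    _ = (1 - r) • a + r • (algebraMap ℝ A M - a) := by
        rw [cfc_add a (fun s : ℝ => (1 - r) * s) (fun s : ℝ => r * (M - s)),
          cfc_const_mul_id (1 - r) a, cfc_const_mul r (fun s : ℝ => M - s) a, ← hsub]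

lemma norm_rpow_mul_rpow_add_le_of_half_le {a b : A} (ha : 0 ≤ a) (hb : 0 ≤ b) {t : ℝ}
    (ht : t ∈ Set.Icc (1 / 2 : ℝ) (3 / 4)) :
    ‖a ^ t * b ^ (1 - t) + b ^ t * a ^ (1 - t)‖ ≤ ‖a + b‖ := by
  obtain ⟨ht0, ht1⟩ := ht
  set M := ‖a + b‖
  have hab : 0 ≤ a + b := add_nonneg ha hb
  have hM : a + b ≤ algebraMap ℝ A M := IsSelfAdjoint.le_algebraMap_norm_self
  have hM' : b + a ≤ algebraMap ℝ A M := add_comm a b ▸ hM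
  have hr : 2 * t - 1 ∈ Set.Icc (0 : ℝ) 1 := ⟨by linarith, by linarith⟩
  have hhalf : (1 - (2 * t - 1)) / 2 = 1 - t := by ring
  have hsq : ∀ c : A, 0 ≤ c → c ^ (1 / 2 : ℝ) * star (c ^ (1 / 2 : ℝ)) = c := fun c hc => by
    rw [CFC.star_rpow, CFC.rpow_mul_rpow_of_nonneg _ (by norm_num) (by norm_num), add_halves,
      CFC.rpow_one c]
  have hsplit : ∀ c : A, c ^ t = c ^ (1 / 2 : ℝ) * c ^ (t - 1 / 2) := fun c => by
    rw [CFC.rpow_mul_rpow_of_nonneg _ (by norm_num) (by linarith), add_sub_cancel]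
  have hcol : ∀ c d : A, star (c ^ (t - 1 / 2) * d ^ (1 - t)) * (c ^ (t - 1 / 2) * d ^ (1 - t)) =
      d ^ (1 - t) * c ^ (2 * t - 1) * d ^ (1 - t) := fun c d => by
    rw [star_mul, CFC.star_rpow, CFC.star_rpow, mul_assoc, ← mul_assoc (c ^ (t - 1 / 2)),
      CFC.rpow_mul_rpow_of_nonneg _ (by linarith) (by linarith), ← mul_assoc]
    ring_nf
  have hbound : ‖b ^ (1 - t) * a ^ (2 * t - 1) * b ^ (1 - t) +
      a ^ (1 - t) * b ^ (2 * t - 1) * a ^ (1 - t)‖ ≤ M := by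
    have h0 : 0 ≤ b ^ (1 - t) * a ^ (2 * t - 1) * b ^ (1 - t) +
        a ^ (1 - t) * b ^ (2 * t - 1) * a ^ (1 - t) := by
      rw [← hcol, ← hcol]
      exact add_nonneg (star_mul_self_nonneg _) (star_mul_self_nonneg _)
    rw [CStarAlgebra.norm_le_iff_le_algebraMap _ (norm_nonneg _) h0]
    have h1 := CFC.rpow_conj_rpow_le ha hb hM hr
    have h2 := CFC.rpow_conj_rpow_le hb ha hM' hr
    rw [hhalf] at h1 h2
    refine (add_le_add h2 h1).trans ?_
    have h3 : (3 - 4 * t) • (a + b) ≤ (3 - 4 * t) • algebraMap ℝ A M :=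
      smul_le_smul_of_nonneg_left hM (by linarith)
    calc _ = (3 - 4 * t) • (a + b) + (4 * t - 2) • algebraMap ℝ A M := by module
      _ ≤ (3 - 4 * t) • algebraMap ℝ A M + (4 * t - 2) • algebraMap ℝ A M := by gcongr
      _ = algebraMap ℝ A M := by module
  have hcs := CStarAlgebra.norm_mul_add_mul_sq_le (a ^ (1 / 2 : ℝ)) (b ^ (1 / 2 : ℝ))
    (a ^ (t - 1 / 2) * b ^ (1 - t)) (b ^ (t - 1 / 2) * a ^ (1 - t))
  rw [hsq a ha, hsq b hb, hcol, hcol, ← mul_assoc, ← mul_assoc, ← hsplit, ← hsplit] at hcs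
  refine (sq_le_sq₀ (norm_nonneg _) (norm_nonneg _)).mp (hcs.trans ?_)
  rw [sq]
  gcongr

end CrossedHeinz

/-- **Bourin-type bound with sharp constant 1 (operator-norm case).**
For positive elements `a, b` of a unital C*-algebra and `t ∈ [1/4, 3/4]`,
`‖a^t b^(1-t) + b^t a^(1-t)‖ ≤ ‖a + b‖`, with real powers via the
continuous functional calculus. -/
theorem crossed_heinz_central_range_cstar {A : Type*} [CStarAlgebra A]
    [PartialOrder A] [StarOrderedRing A]
    (a b : A) (ha : 0 ≤ a) (hb : 0 ≤ b) (t : ℝ)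
    (ht : t ∈ Set.Icc (1 / 4 : ℝ) (3 / 4)) :
    ‖CFC.rpow a t * CFC.rpow b (1 - t) + CFC.rpow b t * CFC.rpow a (1 - t)‖ ≤
      ‖a + b‖ := by
  change ‖a ^ t * b ^ (1 - t) + b ^ t * a ^ (1 - t)‖ ≤ ‖a + b‖
  obtain ⟨ht0, ht1⟩ := ht
  rcases le_total (1 / 2) t with h | h
  · exact norm_rpow_mul_rpow_add_le_of_half_le ha hb ⟨h, ht1⟩
  · have key := norm_rpow_mul_rpow_add_le_of_half_le ha hb (t := 1 - t)
      ⟨by linarith, by linarith⟩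
    rw [← norm_star, star_add, star_mul, star_mul, CFC.star_rpow, CFC.star_rpow, CFC.star_rpow,
      CFC.star_rpow, add_comm]
    simpa only [sub_sub_cancel] using key
end

section
/- Let 𝒜 be a unital C*-algebra, let a, b ∈ 𝒜 be positive elements, and let t ∈ (0,1). Then ‖a^t b^(1-t) + a^(1-t) b^t‖ ≤ ‖a + b‖. -/
open Filter Topology

section Auxiliary

variable {A : Type*} [CStarAlgebra A] [PartialOrder A] [StarOrderedRing A]

theorem norm_pow_mul_one_sub_le {c : A} (hc : 0 ≤ c) (hc1 : ‖c‖ ≤ 1) (n : ℕ) :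
    ‖c ^ n * (1 - c)‖ ≤ 1 / (n + 1) := by
  have hsa : IsSelfAdjoint c := hc.isSelfAdjoint
  have key : c ^ n * (1 - c) = cfc (fun x : ℝ => x ^ n * (1 - x)) c := by
    rw [cfc_mul _ _ c, cfc_pow_id c n, cfc_sub _ _ c, cfc_const_one ℝ c, cfc_id' ℝ c]
  rw [key]
  refine norm_cfc_le (by positivity) fun x hx => ?_
  have h0 : 0 ≤ x := spectrum_nonneg_of_nonneg hc hx
  have h1 : x ≤ 1 := by
    have := spectrum.norm_le_norm_mul_of_mem hx
    have h2 : ‖(1 : A)‖ ≤ 1 := by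
      rcases subsingleton_or_nontrivial A with _ | _
      · simp [Subsingleton.elim (1 : A) 0]
      · simp
    rw [Real.norm_of_nonneg h0] at this
    nlinarith [norm_nonneg c, norm_nonneg (1 : A)]
  rw [Real.norm_of_nonneg (mul_nonneg (pow_nonneg h0 n) (by linarith)), le_div_iff₀ (by positivity)]
  have hgeom : (n + 1 : ℝ) * x ^ n ≤ ∑ k ∈ Finset.range (n + 1), x ^ k := by
    have := Finset.card_nsmul_le_sum (Finset.range (n + 1)) (fun k => x ^ k) (x ^ n)
      fun k hk => pow_le_pow_of_le_one h0 h1 (by simpa [Nat.lt_succ_iff] using hk)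
    simpa using this
  have := mul_neg_geom_sum x (n + 1)
  nlinarith [mul_le_mul_of_nonneg_left hgeom (sub_nonneg.2 h1), pow_nonneg h0 (n + 1)]

theorem tendsto_norm_pow_mul_mul_pow {c B : A} (hc : 0 ≤ c) (hc1 : ‖c‖ ≤ 1) (hB : 0 ≤ B)
    {κ : ℝ} (hκ : κ < 2) (h : c * B + B * c ≤ κ • B) :
    Tendsto (fun n : ℕ => ‖c ^ n * B * c ^ n‖) atTop (𝓝 0) := by
  have hsa : IsSelfAdjoint c := hc.isSelfAdjoint
  have hpow (n : ℕ) : ‖c ^ n‖ ≤ ‖(1 : A)‖ + 1 := by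
    rcases n.eq_zero_or_pos with rfl | hn
    · simp
    · exact ((norm_pow_le' c hn).trans (pow_le_one₀ (norm_nonneg c) hc1)).trans
        (by linarith [norm_nonneg (1 : A)])
  have hle : (2 - κ) • B ≤ (1 - c) * B + B * (1 - c) := by
    have e : (1 - c) * B + B * (1 - c) - (2 - κ) • B = κ • B - (c * B + B * c) := by
      rw [sub_smul, two_smul]; noncomm_ring
    rw [← sub_nonneg, e, sub_nonneg]; exact h
  have bound (n : ℕ) : ‖c ^ n * B * c ^ n‖ ≤
      (2 * ‖B‖ * (‖(1 : A)‖ + 1) / (2 - κ)) * (1 / ((n : ℝ) + 1)) := by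
    have h1 := star_left_conjugate_le_conjugate hle (c ^ n)
    rw [(hsa.pow n).star_eq] at h1
    have hpos : 0 ≤ c ^ n * ((2 - κ) • B) * c ^ n := by
      have := star_left_conjugate_nonneg (smul_nonneg (by linarith : (0 : ℝ) ≤ 2 - κ) hB) (c ^ n)
      rwa [(hsa.pow n).star_eq] at this
    have h2 := CStarAlgebra.norm_le_norm_of_nonneg_of_le hpos h1
    have e1 : c ^ n * ((2 - κ) • B) * c ^ n = (2 - κ) • (c ^ n * B * c ^ n) := by simp
    have e2 : c ^ n * ((1 - c) * B + B * (1 - c)) * c ^ n =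
        (c ^ n * (1 - c)) * B * c ^ n + c ^ n * B * (c ^ n * (1 - c)) := by
      have : c ^ n * (1 - c) = (1 - c) * c ^ n := by
        rw [mul_sub, sub_mul, mul_one, one_mul, ← pow_succ, ← pow_succ']
      rw [show c ^ n * B * (c ^ n * (1 - c)) = c ^ n * B * ((1 - c) * c ^ n) by rw [this]]
      noncomm_ring
    rw [e1, e2, norm_smul, Real.norm_of_nonneg (by linarith)] at h2
    have hd := norm_pow_mul_one_sub_le hc hc1 n
    set d := c ^ n * (1 - c)
    have h3 : ‖d * B * c ^ n + c ^ n * B * d‖ ≤ 2 * ‖B‖ * (‖(1 : A)‖ + 1) * (1 / ((n : ℝ) + 1)) := by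
      calc _ ≤ ‖d‖ * ‖B‖ * ‖c ^ n‖ + ‖c ^ n‖ * ‖B‖ * ‖d‖ :=
            (norm_add_le _ _).trans (add_le_add (norm_mul₃_le ..) (norm_mul₃_le ..))
        _ = 2 * ‖B‖ * ‖c ^ n‖ * ‖d‖ := by ring
        _ ≤ _ := by gcongr; exact hpow n
    rw [div_mul_eq_mul_div, le_div_iff₀ (by linarith)]
    linarith
  refine squeeze_zero (fun n => norm_nonneg _) bound ?_
  simpa using tendsto_one_div_add_atTop_nhds_zero_nat.const_mul
    (2 * ‖B‖ * (‖(1 : A)‖ + 1) / (2 - κ))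

theorem star_mul_mul_add_le_smul (p q S : A) {s : ℝ} (hs : 0 < s) (hS : ‖S‖ ≤ s) :
    star p * S * q + star q * star S * p ≤ s • (star p * p + star q * q) := by
  have h1 : star q * (star S * S) * q ≤ (s * s) • (star q * q) := by
    refine (CStarAlgebra.star_left_conjugate_le_norm_smul (.star_mul_self S)).trans ?_
    refine smul_le_smul_of_nonneg_right ?_ (star_mul_self_nonneg q)
    rw [CStarRing.norm_star_mul_self]
    gcongr
  have h2 := star_mul_self_nonneg (s • p - S * q)
  have e : star (s • p - S * q) * (s • p - S * q) =
      (s * s) • (star p * p) + star q * (star S * S) * q -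
        s • (star p * S * q + star q * star S * p) := by
    simp only [star_sub, star_smul, star_trivial, star_mul, mul_sub, sub_mul, smul_add,
      smul_mul_assoc, mul_smul_comm, mul_assoc]
    module
  rw [e, sub_nonneg] at h2
  have h3 : s • (star p * S * q + star q * star S * p) ≤ s • (s • (star p * p + star q * q)) := by
    rw [smul_smul, smul_add (s * s)]
    exact h2.trans (by gcongr)
  exact (smul_le_smul_iff_of_pos_left hs).1 h3

/-- The arithmetic-geometric mean inequality for the norm of a C⋆-algebra. -/
theorem two_mul_norm_mul_mul_le (a b x : A) (ha : IsSelfAdjoint a) (hb : IsSelfAdjoint b) :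
    2 * ‖a * x * b‖ ≤ ‖a * a * x + x * (b * b)‖ := by
  by_contra! hlt
  obtain ⟨s, hs1, hs2⟩ := exists_between hlt
  have hs0 : 0 < s := (norm_nonneg _).trans_lt hs1
  set T := a * x * b with hT
  set l := ‖T‖ with hl
  have hl0 : 0 < l := by linarith
  set c : A := (l * l)⁻¹ • (star T * T) with hc
  have hcn : 0 ≤ c := smul_nonneg (by positivity) (star_mul_self_nonneg T)
  have hc1 : ‖c‖ = 1 := by
    rw [hc, norm_smul, CStarRing.norm_star_mul_self, Real.norm_of_nonneg (by positivity)]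
    exact inv_mul_cancel₀ (by positivity)
  have hTT : star T * T = (l * l) • c := by
    rw [hc, smul_smul, mul_inv_cancel₀ (by positivity), one_smul]
  have hBn : 0 ≤ b * b := by simpa [hb.star_eq] using star_mul_self_nonneg b
  have hle : c * (b * b) + (b * b) * c ≤ (s / l) • (b * b) := by
    have h1 := star_mul_mul_add_le_smul (a * a * x * b) (l • b) _ hs0 hs1.le
    have h0 : (0 : A) ≤ (2 * l - s) • (star (a * a * x * b) * (a * a * x * b)) :=
      smul_nonneg (by linarith) (star_mul_self_nonneg _)
    set P := star (a * a * x * b) * (a * a * x * b) with hP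
    have e1 : star (a * a * x * b) * (a * a * x + x * (b * b)) * (l • b) =
        l • P + (l * (l * l)) • (c * (b * b)) := by
      rw [mul_smul (l : ℝ) (l * l) (c * (b * b)), ← smul_mul_assoc (l * l), ← hTT, ← smul_add,
        mul_smul_comm, hP, hT]
      congr 1
      simp only [star_mul, ha.star_eq, hb.star_eq]
      noncomm_ring
    have e2 : star (l • b) * star (a * a * x + x * (b * b)) * (a * a * x * b) =
        l • P + (l * (l * l)) • ((b * b) * c) := by
      have := congrArg star e1
      simpa [hP, hcn.isSelfAdjoint.star_eq, hb.star_eq, mul_assoc] using this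
    have e3 : star (l • b) * (l • b) = (l * l) • (b * b) := by
      simp [hb.star_eq, smul_smul]
    rw [e1, e2, e3] at h1
    have h2 : (l * (l * l)) • (c * (b * b) + (b * b) * c) ≤
        (l * (l * l)) • ((s / l) • (b * b)) := by
      rw [smul_smul, show l * (l * l) * (s / l) = s * (l * l) by field_simp, ← sub_nonneg]
      refine (add_nonneg h0 (sub_nonneg.2 h1)).trans_eq ?_
      module
    exact (smul_le_smul_iff_of_pos_left (by positivity)).1 h2
  have hlim := tendsto_norm_pow_mul_mul_pow hcn hc1.le hBn (by rwa [div_lt_iff₀ hl0]) hle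
  set Y : A := (l * l)⁻¹ • (star T * (a * x)) with hY
  have hYb : c = Y * b := by simp [hc, hY, hT, mul_assoc]
  have hone (n : ℕ) : 1 ≤ ‖Y‖ ^ 2 * ‖c ^ n * (b * b) * c ^ n‖ := by
    have h1 : ‖c ^ (n + 1)‖ = 1 := by
      rw [← CFC.rpow_natCast c (n + 1), CFC.norm_rpow c (by positivity), hc1, Real.one_rpow]
    have h2 : ‖c ^ n * (b * b) * c ^ n‖ = ‖b * c ^ n‖ ^ 2 := by
      rw [sq, ← CStarRing.norm_star_mul_self, star_mul, hb.star_eq,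
        (hcn.isSelfAdjoint.pow n).star_eq]
      simp only [mul_assoc]
    have h3 : (1 : ℝ) ≤ ‖Y‖ * ‖b * c ^ n‖ := by
      rw [← h1, pow_succ']
      nth_rewrite 1 [hYb]
      rw [mul_assoc]
      exact norm_mul_le _ _
    rw [h2, ← mul_pow]
    exact one_le_pow₀ h3
  have := ge_of_tendsto' (hlim.const_mul (‖Y‖ ^ 2)) hone
  norm_num at this

theorem CFC.rpow_add_of_nonneg {a : A} (ha : 0 ≤ a) {x y : ℝ} (hx : 0 ≤ x) (hy : 0 ≤ y) :
    a ^ (x + y) = a ^ x * a ^ y := by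
  rcases hx.eq_or_lt with rfl | hx
  · simp [CFC.rpow_zero a]
  rcases hy.eq_or_lt with rfl | hy
  · simp [CFC.rpow_zero a]
  lift x to NNReal using hx.le
  lift y to NNReal using hy.le
  norm_cast at hx hy
  rw [← NNReal.coe_add, ← CFC.nnrpow_eq_rpow (add_pos hx hy), ← CFC.nnrpow_eq_rpow hx,
    ← CFC.nnrpow_eq_rpow hy, CFC.nnrpow_add hx hy]

theorem CFC.norm_rpow_le_of_mem_Icc {a : A} (ha : 0 ≤ a) {r : ℝ} (hr : r ∈ Set.Icc (0 : ℝ) 1) :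
    ‖a ^ r‖ ≤ ‖(1 : A)‖ + max 1 ‖a‖ := by
  rcases hr.1.eq_or_lt with rfl | h0
  · rw [CFC.rpow_zero a]
    linarith [le_max_left 1 ‖a‖]
  · rw [CFC.norm_rpow a h0]
    calc ‖a‖ ^ r ≤ (max 1 ‖a‖) ^ r := by gcongr; exact le_max_right _ _
      _ ≤ max 1 ‖a‖ := by
        simpa using Real.rpow_le_rpow_of_exponent_le (le_max_left 1 ‖a‖) hr.2
      _ ≤ _ := by linarith [norm_nonneg (1 : A)]

end Auxiliary

theorem le_of_forall_le_add_half {g : ℝ → ℝ} {N C : ℝ} (hC : ∀ v ∈ Set.Icc (0 : ℝ) 1, g v ≤ N + C)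
    (hsymm : ∀ v, g (1 - v) = g v) (hhalf : ∀ v ∈ Set.Icc (0 : ℝ) (1 / 2), g v ≤ (g (2 * v) + N) / 2)
    {v : ℝ} (hv : v ∈ Set.Icc (0 : ℝ) 1) : g v ≤ N := by
  have H (n : ℕ) : ∀ v ∈ Set.Icc (0 : ℝ) 1, g v ≤ N + C * (1 / 2) ^ n := by
    induction n with
    | zero => simpa using hC
    | succ n ih =>
      have step (v : ℝ) (hv : v ∈ Set.Icc (0 : ℝ) (1 / 2)) : g v ≤ N + C * (1 / 2) ^ (n + 1) := by
        have h1 := hhalf v hv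
        have h2 := ih (2 * v) ⟨by linarith [hv.1], by linarith [hv.2]⟩
        rw [pow_succ]
        linarith
      intro v hv
      rcases le_total v (1 / 2) with h | h
      · exact step v ⟨hv.1, h⟩
      · rw [← hsymm]
        exact step (1 - v) ⟨by linarith [hv.2], by linarith⟩
  have hlim : Tendsto (fun n : ℕ => N + C * (1 / 2 : ℝ) ^ n) atTop (𝓝 N) := by
    simpa using ((tendsto_pow_atTop_nhds_zero_of_lt_one (r := (1 / 2 : ℝ)) (by norm_num)
      (by norm_num)).const_mul C).const_add N
  exact ge_of_tendsto' hlim fun n => H n v hv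

/-- **Classical Heinz inequality (operator-norm case).** For positive elements
`a, b` of a unital C*-algebra and `t ∈ (0,1)`,
`‖a^t b^(1-t) + a^(1-t) b^t‖ ≤ ‖a + b‖`, with real powers via the continuous
functional calculus. -/
theorem heinz_inequality_cstar {A : Type*} [CStarAlgebra A]
    [PartialOrder A] [StarOrderedRing A]
    (a b : A) (ha : 0 ≤ a) (hb : 0 ≤ b) (t : ℝ) (ht : t ∈ Set.Ioo (0 : ℝ) 1) :
    ‖CFC.rpow a t * CFC.rpow b (1 - t) + CFC.rpow a (1 - t) * CFC.rpow b t‖ ≤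
      ‖a + b‖ := by
  simp only [CFC.rpow_eq_pow]
  refine le_of_forall_le_add_half
    (g := fun v => ‖a ^ v * b ^ (1 - v) + a ^ (1 - v) * b ^ v‖)
    (C := 2 * ((‖(1 : A)‖ + max 1 ‖a‖) * (‖(1 : A)‖ + max 1 ‖b‖))) ?_ ?_ ?_
    (Set.Ioo_subset_Icc_self ht)
  · intro v hv
    have hv' : 1 - v ∈ Set.Icc (0 : ℝ) 1 := ⟨by linarith [hv.2], by linarith [hv.1]⟩
    have hmul {r s : ℝ} (hr : r ∈ Set.Icc (0 : ℝ) 1) (hs : s ∈ Set.Icc (0 : ℝ) 1) :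
        ‖a ^ r * b ^ s‖ ≤ (‖(1 : A)‖ + max 1 ‖a‖) * (‖(1 : A)‖ + max 1 ‖b‖) :=
      (norm_mul_le _ _).trans <| mul_le_mul (CFC.norm_rpow_le_of_mem_Icc ha hr)
        (CFC.norm_rpow_le_of_mem_Icc hb hs) (norm_nonneg _) (by positivity)
    have := norm_add_le (a ^ v * b ^ (1 - v)) (a ^ (1 - v) * b ^ v)
    linarith [hmul hv hv', hmul hv' hv, norm_nonneg (a + b)]
  · intro v
    simp only [sub_sub_cancel]
    rw [add_comm]
  · rintro v ⟨hv0, hv1⟩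
    have hw : 0 ≤ 1 - 2 * v := by linarith
    have split {d : A} (hd : 0 ≤ d) :
        d ^ (1 - v) = d ^ v * d ^ (1 - 2 * v) ∧ d ^ (1 - v) = d ^ (1 - 2 * v) * d ^ v ∧
          d ^ (2 * v) = d ^ v * d ^ v ∧ d ^ v * d ^ v * d ^ (1 - 2 * v) = d ∧
          d ^ (1 - 2 * v) * (d ^ v * d ^ v) = d := by
      simp only [← CFC.rpow_add_of_nonneg hd, hv0, hw, add_nonneg]
      ring_nf
      simp [CFC.rpow_one d]
    obtain ⟨ha1, -, ha2, ha3, -⟩ := split ha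
    obtain ⟨-, hb1, hb2, -, hb3⟩ := split hb
    have key := two_mul_norm_mul_mul_le (a ^ v) (b ^ v) (a ^ (1 - 2 * v) + b ^ (1 - 2 * v))
      CFC.rpow_nonneg.isSelfAdjoint CFC.rpow_nonneg.isSelfAdjoint
    have e1 : a ^ v * (a ^ (1 - 2 * v) + b ^ (1 - 2 * v)) * b ^ v =
        a ^ v * b ^ (1 - v) + a ^ (1 - v) * b ^ v := by
      rw [ha1, hb1]; noncomm_ring
    have e2 : a ^ v * a ^ v * (a ^ (1 - 2 * v) + b ^ (1 - 2 * v)) +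
        (a ^ (1 - 2 * v) + b ^ (1 - 2 * v)) * (b ^ v * b ^ v) =
        (a ^ (2 * v) * b ^ (1 - 2 * v) + a ^ (1 - 2 * v) * b ^ (2 * v)) + (a + b) := by
      rw [mul_add, add_mul, ha3, hb3, ha2, hb2]; abel
    rw [e1, e2] at key
    have := key.trans (norm_add_le _ _)
    linarith
end
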